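/- Let P_Θ be a locally finite marked point set in ℝ² satisfying Conditions D and admitting no descending chain of Type 2, and define the T₂-iterates f₀:=0, f_{n+1}:=T₂f_n with monotone limits f and g. Then f = g. -/

import Mathlib

open scoped ENNReal
open Real

noncomputable section

namespace Lilypond

/-- Points of the Euclidean plane. -/
abbrev Pt := EuclideanSpace ℝ (Fin 2)

/-- A marked point: a centre in the plane together with a direction. -/
abbrev MPt := Pt × ℝ

/-- The unit vector in direction `θ`. -/
def dirVec (θ : ℝ) : Pt := (WithLp.equiv 2 (Fin 2 → ℝ)).symm ![Real.cos θ, Real.sin θ]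

/-- The full line through the centre of `p` in the direction of `p`. -/
def lineThru (p : MPt) : Set Pt := {q | ∃ t : ℝ, q = p.1 + t • dirVec p.2}

open Classical in
/-- A point of intersection of the lines through `i` and `j` (junk value if disjoint). -/
def interPt (i j : MPt) : Pt :=
  if h : (lineThru i ∩ lineThru j).Nonempty then h.choose else 0

open Classical in
/-- The distance `dᵢⱼ` from the centre of `i` to the intersection point of the lines
through `i` and `j`; if the directions coincide it is half the distance between the centres
when `j` lies on the line through `i`, and `∞` otherwise. -/
def dD (i j : MPt) : ℝ≥0∞ :=
  if i.2 = j.2 then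
    (if j.1 ∈ lineThru i then edist i.1 j.1 / 2 else ⊤)
  else edist i.1 (interPt i j)

/-- `A` is a locally finite marked point set: all directions lie in `[0, π)` and only finitely
many centres lie in any bounded region. -/
def MarkedLocFin (A : Set MPt) : Prop :=
  (∀ p ∈ A, p.2 ∈ Set.Ico 0 Real.pi) ∧
    ∀ B : Set Pt, Bornology.IsBounded B → {p ∈ A | p.1 ∈ B}.Finite

/-- Conditions D: all finite distances `dᵢⱼ` (`i ≠ j`) are mutually distinct. -/
def CondD (A : Set MPt) : Prop :=
  ∀ i ∈ A, ∀ j ∈ A, ∀ k ∈ A, ∀ l ∈ A,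
    i ≠ j → k ≠ l → (i, j) ≠ (k, l) → dD i j ≠ ⊤ → dD k l ≠ ⊤ → dD i j ≠ dD k l

/-- The set `Dᵢ(f)` of Model 1. -/
def D1 (A : Set MPt) (f : MPt → ℝ≥0∞) (i : MPt) : Set ℝ≥0∞ :=
  {x | ∃ j ∈ A, j ≠ i ∧ x = dD i j ∧ dD j i < dD i j ∧ dD j i < f j}

/-- The operator `T₁` of Model 1 (with `sInf ∅ = ∞`). -/
def T1 (A : Set MPt) (f : MPt → ℝ≥0∞) (i : MPt) : ℝ≥0∞ := sInf (D1 A f i)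

/-- The set `D⁽²⁾ᵢ(f)` of Model 2. -/
def D2 (A : Set MPt) (f : MPt → ℝ≥0∞) (i : MPt) : Set ℝ≥0∞ :=
  {x | ∃ j ∈ A, j ≠ i ∧ x = max (dD i j) (dD j i) ∧ dD j i ≤ f j}

/-- The operator `T₂` of Model 2 (with `sInf ∅ = ∞`). -/
def T2 (A : Set MPt) (f : MPt → ℝ≥0∞) (i : MPt) : ℝ≥0∞ := sInf (D2 A f i)

/-- The relative interior of the segment of half-length `r` centred at `p`. -/
def S0 (p : MPt) (r : ℝ≥0∞) : Set Pt :=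
  {q | ∃ t : ℝ, ENNReal.ofReal |t| < r ∧ q = p.1 + t • dirVec p.2}

/-- `f` is a hard-segment (HS) function on `A`. -/
def IsHS (A : Set MPt) (f : MPt → ℝ≥0∞) : Prop :=
  ∀ i ∈ A, ∀ j ∈ A, i ≠ j → Disjoint (S0 i (f i)) (S0 j (f j))

/-- `j` is a Type 1 stopping segment neighbour of `i` for `f`. -/
def StopNbr1 (A : Set MPt) (f : MPt → ℝ≥0∞) (i j : MPt) : Prop :=
  j ∈ A ∧ j ≠ i ∧ f i = dD i j ∧ dD j i < dD i j ∧ dD j i < f j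

/-- `f` is a GMHS function of Type 1 on `A`. -/
def IsGMHS1 (A : Set MPt) (f : MPt → ℝ≥0∞) : Prop :=
  IsHS A f ∧ ∀ i ∈ A, f i < ⊤ → ∃ j, StopNbr1 A f i j

/-- `j` is a Type 2 stopping segment neighbour of `i` for `f`. -/
def StopNbr2 (A : Set MPt) (f : MPt → ℝ≥0∞) (i j : MPt) : Prop :=
  j ∈ A ∧ j ≠ i ∧ f i = max (dD i j) (dD j i) ∧ dD j i ≤ f j

/-- `f` is a GMHS function of Type 2 on `A`. -/
def IsGMHS2 (A : Set MPt) (f : MPt → ℝ≥0∞) : Prop :=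
  IsHS A f ∧ ∀ i ∈ A, f i < ⊤ → ∃ j, StopNbr2 A f i j

/-- `A` has a descending chain of Type 1. -/
def HasDescChain1 (A : Set MPt) : Prop :=
  ∃ P : ℕ → MPt, (∀ n, P n ∈ A) ∧ Function.Injective P ∧
    dD (P 0) (P 1) < ⊤ ∧
    ∀ n : ℕ, dD (P (n+1)) (P n) ≤ dD (P n) (P (n+1)) ∧
      dD (P (n+1)) (P (n+2)) ≤ dD (P (n+1)) (P n)

/-- `A` has a descending chain of Type 2. -/
def HasDescChain2 (A : Set MPt) : Prop :=
  ∃ P : ℕ → MPt, (∀ n, P n ∈ A) ∧ Function.Injective P ∧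
    dD (P 1) (P 0) < ⊤ ∧
    ∀ n : ℕ, max (dD (P (n+1)) (P (n+2))) (dD (P (n+2)) (P (n+1))) ≤ dD (P (n+1)) (P n)

/-- The `T₁`-iterates `f₀ := 0`, `f_{n+1} := T₁ f_n`. -/
def iter1 (A : Set MPt) : ℕ → MPt → ℝ≥0∞
  | 0 => fun _ => 0
  | n + 1 => T1 A (iter1 A n)

/-- The monotone limit `f` of the even `T₁`-iterates. -/
def limEven1 (A : Set MPt) (p : MPt) : ℝ≥0∞ := ⨆ n, iter1 A (2 * n) p

/-- The monotone limit `g` of the odd `T₁`-iterates. -/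
def limOdd1 (A : Set MPt) (p : MPt) : ℝ≥0∞ := ⨅ n, iter1 A (2 * n + 1) p

/-- The `T₂`-iterates `f₀ := 0`, `f_{n+1} := T₂ f_n`. -/
def iter2 (A : Set MPt) : ℕ → MPt → ℝ≥0∞
  | 0 => fun _ => 0
  | n + 1 => T2 A (iter2 A n)

/-- The monotone limit `f` of the even `T₂`-iterates. -/
def limEven2 (A : Set MPt) (p : MPt) : ℝ≥0∞ := ⨆ n, iter2 A (2 * n) p

/-- The monotone limit `g` of the odd `T₂`-iterates. -/
def limOdd2 (A : Set MPt) (p : MPt) : ℝ≥0∞ := ⨅ n, iter2 A (2 * n + 1) p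


lemma interPt_comm (i j : MPt) : interPt i j = interPt j i := by
  unfold interPt
  have key : ∀ S T : Set Pt, S = T →
      (open Classical in if h : S.Nonempty then h.choose else (0 : Pt)) =
        (open Classical in if h : T.Nonempty then h.choose else (0 : Pt)) := by
    rintro S _ rfl
    rfl
  exact key _ _ (Set.inter_comm _ _)

lemma edist_le_dD_add_dD (i j : MPt) : edist i.1 j.1 ≤ dD i j + dD j i := by
  by_cases h : i.2 = j.2
  · by_cases hij : j.1 ∈ lineThru i
    · by_cases hji : i.1 ∈ lineThru j
      · simp only [dD, h, hij, hji, if_true]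
        rw [edist_comm j.1 i.1, ENNReal.add_halves]
      · simp [dD, h, hji]
    · simp [dD, h, hij]
  · rw [dD, dD, if_neg h, if_neg (Ne.symm h), interPt_comm j i, edist_comm j.1]
    exact edist_triangle _ _ _

lemma MarkedLocFin.finite_max_dD_le {A : Set MPt} (hA : MarkedLocFin A) (i : MPt) {R : ℝ≥0∞}
    (hR : R ≠ ⊤) : {j ∈ A | max (dD i j) (dD j i) ≤ R}.Finite := by
  have hR' : R + R ≠ ⊤ := ENNReal.add_ne_top.2 ⟨hR, hR⟩
  refine (hA.2 (Metric.closedBall i.1 (R + R).toReal) Metric.isBounded_closedBall).subset ?_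
  rintro j ⟨hj, hle⟩
  refine ⟨hj, ?_⟩
  rw [Metric.mem_closedBall, dist_comm, dist_edist]
  refine ENNReal.toReal_mono hR' ((edist_le_dD_add_dD i j).trans ?_)
  exact add_le_add ((le_max_left _ _).trans hle) ((le_max_right _ _).trans hle)

lemma MarkedLocFin.exists_T2_eq {A : Set MPt} (hA : MarkedLocFin A) (h : MPt → ℝ≥0∞) (i : MPt)
    (hi : T2 A h i ≠ ⊤) :
    ∃ j ∈ A, j ≠ i ∧ T2 A h i = max (dD i j) (dD j i) ∧ dD j i ≤ h j := by
  obtain ⟨x, hx, hxtop⟩ := sInf_lt_iff.1 (lt_top_iff_ne_top.2 hi)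
  have hfin : {y ∈ D2 A h i | y ≤ x}.Finite := by
    refine ((hA.finite_max_dD_le i hxtop.ne).image fun j => max (dD i j) (dD j i)).subset ?_
    rintro _ ⟨⟨j, hj, -, rfl, -⟩, hle⟩
    exact ⟨j, ⟨hj, hle⟩, rfl⟩
  obtain ⟨m, ⟨hm, hmx⟩, hmin⟩ := Set.exists_min_image _ id hfin ⟨x, hx, le_rfl⟩
  have hT : T2 A h i = m := by
    refine le_antisymm (sInf_le hm) (le_sInf fun y hy => ?_)
    rcases le_total y x with hyx | hyx
    · exact hmin y ⟨hy, hyx⟩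
    · exact hmx.trans hyx
  obtain ⟨j, hj, hne, hmj, hle⟩ := hm
  exact ⟨j, hj, hne, hT.trans hmj, hle⟩

lemma T2_antitone (A : Set MPt) : Antitone (T2 A) := by
  intro f g hfg i
  refine sInf_le_sInf ?_
  rintro x ⟨j, hj, hne, hx, hle⟩
  exact ⟨j, hj, hne, hx, hle.trans (hfg j)⟩

lemma iter2_even_monotone (A : Set MPt) : Monotone fun n => iter2 A (2 * n) := by
  refine monotone_nat_of_le_succ fun n => ?_
  induction n with
  | zero => exact fun _ => zero_le
  | succ n ih => exact T2_antitone A (T2_antitone A ih)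

lemma iter2_odd_antitone (A : Set MPt) : Antitone fun n => iter2 A (2 * n + 1) :=
  fun _ _ h => T2_antitone A (iter2_even_monotone A h)

lemma iter2_even_le_odd (A : Set MPt) (n : ℕ) : iter2 A (2 * n) ≤ iter2 A (2 * n + 1) := by
  induction n with
  | zero => exact fun _ => zero_le
  | succ n ih => exact T2_antitone A (T2_antitone A ih)

lemma limEven2_le_limOdd2 (A : Set MPt) (p : MPt) : limEven2 A p ≤ limOdd2 A p :=
  iSup_le fun n => le_iInf fun m =>
    (iter2_even_monotone A (le_max_left n m) p).trans <|
      (iter2_even_le_odd A (max n m) p).trans (iter2_odd_antitone A (le_max_right n m) p)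

lemma MarkedLocFin.exists_le_iter2_even {A : Set MPt} (hA : MarkedLocFin A) {j : MPt}
    {x : ℝ≥0∞} (hx : x ≠ ⊤) (h : x ≤ limEven2 A j) : ∃ n, x ≤ iter2 A (2 * n) j := by
  rcases h.lt_or_eq with hlt | heq
  · obtain ⟨n, hn⟩ := lt_iSup_iff.1 hlt
    exact ⟨n, hn.le⟩
  · have htop : limEven2 A j ≠ ⊤ := heq ▸ hx
    have hfin : (Set.range fun n => iter2 A (2 * n) j).Finite := by
      refine (((hA.finite_max_dD_le j htop).image
        fun k => max (dD j k) (dD k j)).insert 0).subset ?_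
      rintro _ ⟨n, rfl⟩
      cases n with
      | zero => exact Or.inl rfl
      | succ n =>
        have hle : iter2 A (2 * (n + 1)) j ≤ limEven2 A j :=
          le_iSup (fun n => iter2 A (2 * n) j) (n + 1)
        obtain ⟨k, hk, -, hkeq, -⟩ :=
          hA.exists_T2_eq (iter2 A (2 * n + 1)) j (ne_top_of_le_ne_top htop hle)
        exact Or.inr ⟨k, ⟨hk, hkeq ▸ hle⟩, hkeq.symm⟩
    obtain ⟨n, hn⟩ := (Set.range_nonempty _).csSup_mem hfin
    exact ⟨n, heq.le.trans hn.ge⟩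

lemma MarkedLocFin.limOdd2_le_max {A : Set MPt} (hA : MarkedLocFin A) {i j : MPt} (hj : j ∈ A)
    (hne : j ≠ i) (htop : dD j i ≠ ⊤) (h : dD j i ≤ limEven2 A j) :
    limOdd2 A i ≤ max (dD i j) (dD j i) := by
  obtain ⟨n, hn⟩ := hA.exists_le_iter2_even htop h
  exact (iInf_le _ n).trans (sInf_le ⟨j, hj, hne, rfl, hn⟩)

lemma MarkedLocFin.exists_max_le_limEven2 {A : Set MPt} (hA : MarkedLocFin A) {i : MPt}
    (hi : limEven2 A i ≠ ⊤) :
    ∃ j ∈ A, j ≠ i ∧ max (dD i j) (dD j i) ≤ limEven2 A i ∧ dD j i ≤ limOdd2 A j := by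
  by_contra! hcon
  have hev : ∀ᶠ n in Filter.atTop, ∀ j ∈ {j ∈ A | max (dD i j) (dD j i) ≤ limEven2 A i},
      j ≠ i → iter2 A (2 * n + 1) j < dD j i := by
    refine (Filter.eventually_all_finite (hA.finite_max_dD_le i hi)).2 ?_
    rintro j ⟨hj, hle⟩
    by_cases hne : j = i
    · exact Filter.Eventually.of_forall fun _ h => absurd hne h
    · obtain ⟨m, hm⟩ := iInf_lt_iff.1 (hcon j hj hne hle)
      filter_upwards [Filter.eventually_ge_atTop m] with n hn _
      exact (iter2_odd_antitone A hn j).trans_lt hm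
  obtain ⟨n, hn⟩ := hev.exists
  have hle : T2 A (iter2 A (2 * n + 1)) i ≤ limEven2 A i :=
    le_iSup (fun n => iter2 A (2 * n) i) (n + 1)
  obtain ⟨j, hj, hne, heq, hdle⟩ :=
    hA.exists_T2_eq (iter2 A (2 * n + 1)) i (ne_top_of_le_ne_top hi hle)
  exact (hn j ⟨hj, heq ▸ hle⟩ hne).not_ge hdle

lemma MarkedLocFin.exists_next_of_limEven2_lt {A : Set MPt} (hA : MarkedLocFin A) {i : MPt}
    (hi : limEven2 A i < limOdd2 A i) :
    ∃ j ∈ A, limEven2 A j < limOdd2 A j ∧ max (dD i j) (dD j i) ≤ limEven2 A i ∧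
      limEven2 A j < dD j i := by
  obtain ⟨j, hj, hne, hmax, hle⟩ := hA.exists_max_le_limEven2 hi.ne_top
  have hlt : limEven2 A j < dD j i := by
    by_contra! h
    exact ((hA.limOdd2_le_max hj hne
      (ne_top_of_le_ne_top hi.ne_top ((le_max_right _ _).trans hmax)) h).trans hmax).not_gt hi
  exact ⟨j, hj, hlt.trans_le hle, hmax, hlt⟩

lemma MarkedLocFin.hasDescChain2_of_limEven2_lt {A : Set MPt} (hA : MarkedLocFin A) {i : MPt}
    (hiA : i ∈ A) (hi : limEven2 A i < limOdd2 A i) : HasDescChain2 A := by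
  let B := {p : MPt // p ∈ A ∧ limEven2 A p < limOdd2 A p}
  have hnext : ∀ p : B, ∃ q : B, max (dD p.1 q.1) (dD q.1 p.1) ≤ limEven2 A p.1 ∧
      limEven2 A q.1 < dD q.1 p.1 := fun p => by
    obtain ⟨q, hq, hlt, hmax, hd⟩ := hA.exists_next_of_limEven2_lt p.2.2
    exact ⟨⟨q, hq, hlt⟩, hmax, hd⟩
  choose next hmax hlt using hnext
  let P : ℕ → B := fun n => next^[n] ⟨i, hiA, hi⟩
  have hP : ∀ n, P (n + 1) = next (P n) := fun n => Function.iterate_succ_apply' _ _ _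
  have hmaxP : ∀ n, max (dD (P n).1 (P (n + 1)).1) (dD (P (n + 1)).1 (P n).1) ≤
      limEven2 A (P n).1 := fun n => by rw [hP]; exact hmax _
  have hltP : ∀ n, limEven2 A (P (n + 1)).1 < dD (P (n + 1)).1 (P n).1 := fun n => by
    rw [hP]; exact hlt _
  have hanti : StrictAnti fun n => limEven2 A (P n).1 :=
    strictAnti_nat_of_succ_lt fun n =>
      (hltP n).trans_le ((le_max_right _ _).trans (hmaxP n))
  refine ⟨fun n => (P n).1, fun n => (P n).2.1, fun m n h => ?_, ?_, fun n => ?_⟩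
  · exact hanti.injective (congrArg (limEven2 A) h)
  · exact ((le_max_right _ _).trans (hmaxP 0)).trans_lt ((P 0).2.2.trans_le le_top)
  · exact (hmaxP (n + 1)).trans (hltP n).le

/-- Proposition 4.24: in the absence of descending chains of Type 2, the monotone limits
`f` and `g` of the `T₂`-iterates coincide on `P_Θ`. -/
theorem statement19 (A : Set MPt) (hA : MarkedLocFin A) (hD : CondD A)
    (hchain : ¬ HasDescChain2 A) :
    Set.EqOn (limEven2 A) (limOdd2 A) A := by
  intro i hi
  by_contra hne
  exact hchain (hA.hasDescChain2_of_limEven2_lt hi ((limEven2_le_limOdd2 A i).lt_of_ne hne))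

end Lilypond
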